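/- arXiv:2108.05970 — 2 statements merged into one kernel-verified Lean document; each statement's English description precedes it below -/
import Mathlib

section
/- Let G = (V,E) be a multigraph (a graph possibly containing parallel edges and parallel self-loops) with |V| = s ≥ 2 vertices and |E| = m edges, and let ε = ε(s) ∈ (0,1] satisfy m ≥ s(1+ε). Then there exists a set of vertices S ⊆ V with |S| ≤ 8·log₂(s)·⌈1/ε⌉ such that S spans at least |S| + 1 edges. -/
open scoped Classical

noncomputable def spn {V : Type*} (E : Multiset (Sym2 V)) (S : Finset V) : ℕ :=
  Multiset.card (E.filter (fun e => ∀ v ∈ e, v ∈ S))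

noncomputable def bll {V : Type*} (E : Multiset (Sym2 V)) (W : Finset V) (v0 : V) : ℕ → Finset V
  | 0 => {v0}
  | n + 1 => bll E W v0 n ∪ W.filter (fun w => ∃ v ∈ bll E W v0 n, s(v, w) ∈ E)

lemma spn_empty {V : Type*} (E : Multiset (Sym2 V)) : spn E ∅ = 0 := by
  unfold spn
  rw [Multiset.card_eq_zero, Multiset.filter_eq_nil]
  intro e _ h
  induction e with
  | _ a b => exact absurd (h a (by simp)) (by simp)

lemma bll_sub {V : Type*} (E : Multiset (Sym2 V)) (W : Finset V) (v0 : V) (h : v0 ∈ W) (n : ℕ) :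
    bll E W v0 n ⊆ W := by
  induction n with
  | zero => simpa [bll] using h
  | succ n ih =>
    simp only [bll]
    exact Finset.union_subset ih (Finset.filter_subset _ _)

lemma bll_mono {V : Type*} (E : Multiset (Sym2 V)) (W : Finset V) (v0 : V) :
    Monotone (bll E W v0) := by
  apply monotone_nat_of_le_succ
  intro n
  simp only [bll]
  exact Finset.subset_union_left

lemma spn_touch {V : Type*} (E : Multiset (Sym2 V)) (W : Finset V) (v0 : V) (h : v0 ∈ W) (n : ℕ) :
    spn E W ≤ spn E (W \ bll E W v0 n) + spn E (bll E W v0 (n+1)) := by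
  have hsub := bll_sub E W v0 h n
  unfold spn
  rw [← Multiset.card_add, Multiset.filter_add_filter]
  apply Multiset.card_le_card
  refine le_trans ?_ (Multiset.le_add_right _ _)
  have : ∀ e ∈ E, (∀ v ∈ e, v ∈ W) → ((∀ v ∈ e, v ∈ W \ bll E W v0 n) ∨
      (∀ v ∈ e, v ∈ bll E W v0 (n+1))) := by
    intro e he hW
    induction e with
    | _ a b =>
      simp only [Sym2.mem_iff, forall_eq_or_imp, forall_eq] at hW ⊢
      have he2 : s(b, a) ∈ E := by rwa [Sym2.eq_swap]
      simp only [bll, Finset.mem_union, Finset.mem_filter, Finset.mem_sdiff]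
      by_cases h1 : a ∈ bll E W v0 n
      · right
        exact ⟨Or.inl h1, Or.inr ⟨hW.2, a, h1, he⟩⟩
      · by_cases h2 : b ∈ bll E W v0 n
        · right
          exact ⟨Or.inr ⟨hW.1, b, h2, he2⟩, Or.inl h2⟩
        · left
          exact ⟨⟨hW.1, h1⟩, hW.2, h2⟩
  rw [Multiset.le_filter]
  refine ⟨Multiset.filter_le _ _, ?_⟩
  intro e he
  rw [Multiset.mem_filter] at he
  exact this e he.1 he.2

lemma exists_parent {V : Type*} (E : Multiset (Sym2 V)) (W : Finset V) (v0 : V) (r : ℕ) :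
    ∃ (p : V → V) (d : V → ℕ), p v0 = v0 ∧ d v0 = 0 ∧
      ∀ x ∈ bll E W v0 r, d x ≤ r ∧ (x ≠ v0 →
        p x ∈ bll E W v0 r ∧ s(x, p x) ∈ E ∧ d (p x) < d x) := by
  let d : V → ℕ := fun x => sInf {n | x ∈ bll E W v0 n}
  have hd : ∀ n x, x ∈ bll E W v0 n → d x ≤ n := fun n x h => Nat.sInf_le h
  have hm : ∀ n x, x ∈ bll E W v0 n → x ∈ bll E W v0 (d x) := fun n x h =>
    Nat.sInf_mem (s := {n | x ∈ bll E W v0 n}) ⟨n, h⟩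
  have key : ∀ x, ∃ y, (x = v0 → y = v0) ∧ (x ∈ bll E W v0 r → x ≠ v0 →
        y ∈ bll E W v0 r ∧ s(x, y) ∈ E ∧ d y < d x) := by
    intro x
    by_cases hx : x = v0
    · exact ⟨v0, fun _ => rfl, fun _ h => absurd hx h⟩
    by_cases hxr : x ∈ bll E W v0 r
    · have h1 := hm r x hxr
      have h2 := hd r x hxr
      obtain hz | ⟨n, hn⟩ : d x = 0 ∨ ∃ n, d x = n + 1 := by
        cases h : d x
        · simp
        · right; exact ⟨_, rfl⟩
      · rw [hz] at h1
        simp [bll] at h1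
        exact absurd h1 hx
      · have h3 : x ∉ bll E W v0 n := fun h => by have := hd n x h; omega
        rw [hn] at h1
        simp only [bll, Finset.mem_union, Finset.mem_filter] at h1
        rcases h1 with h1 | ⟨_, y, hy, hE⟩
        · exact absurd h1 h3
        · refine ⟨y, fun h => absurd h hx, fun _ _ => ⟨bll_mono E W v0 (by omega) hy, ?_, ?_⟩⟩
          · rwa [Sym2.eq_swap]
          · have := hd n y hy; omega
    · exact ⟨x, fun h => h, fun h => absurd h hxr⟩
  choose p hp using key
  refine ⟨p, d, (hp v0).1 rfl, ?_, fun x hx => ⟨hd r x hx, (hp x).2 hx⟩⟩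
  have := hd 0 v0 (by simp [bll])
  omega

lemma extract {V : Type*} (E : Multiset (Sym2 V)) (W : Finset V) (v0 : V) (r : ℕ)
    (h : (bll E W v0 r).card + 1 ≤ spn E (bll E W v0 r)) :
    ∃ S : Finset V, S.card ≤ 4 * r + 1 ∧ S.card + 1 ≤ spn E S := by
  obtain ⟨p, d, hp0, hd0, H⟩ := exists_parent E W v0 r
  have hv0 : v0 ∈ bll E W v0 r := bll_mono E W v0 (Nat.zero_le r) (by simp [bll])
  generalize bll E W v0 r = B at *
  let g : V → Sym2 V := fun x => s(x, p x)
  have hit : ∀ i, ∀ x ∈ B, p^[i] x ∈ B ∧ (p^[i] x = v0 ∨ d (p^[i] x) + i ≤ d x) := by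
    intro i
    induction i with
    | zero => intro x hx; exact ⟨hx, Or.inr (by simp)⟩
    | succ i ih =>
      intro x hx
      rw [Function.iterate_succ_apply']
      obtain ⟨h1, h2⟩ := ih x hx
      by_cases hv : p^[i] x = v0
      · rw [hv, hp0]; exact ⟨hv0, Or.inl rfl⟩
      · obtain ⟨h3, h4, h5⟩ := (H _ h1).2 hv
        refine ⟨h3, Or.inr ?_⟩
        have := h2.resolve_left hv
        omega
  have hend : ∀ i, r ≤ i → ∀ x ∈ B, p^[i] x = v0 := by
    intro i hi x hx
    obtain ⟨h1, h2⟩ := hit i x hx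
    by_contra hv
    have h3 := h2.resolve_left hv
    have h4 := (H _ hx).1
    have h5 := ((H _ h1).2 hv).2.2
    omega
  have ginj : ∀ x ∈ B.erase v0, ∀ y ∈ B.erase v0, g x = g y → x = y := by
    intro x hx y hy hxy
    rw [Finset.mem_erase] at hx hy
    have hxd := ((H x hx.2).2 hx.1).2.2
    have hyd := ((H y hy.2).2 hy.1).2.2
    simp only [g, Sym2.eq_iff] at hxy
    rcases hxy with ⟨h1, _⟩ | ⟨h1, h2⟩
    · exact h1
    · rw [h2] at hxd; rw [← h1] at hyd; omega
  let TB : Multiset (Sym2 V) := (B.erase v0).val.map g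
  let EB := E.filter (fun e => ∀ v ∈ e, v ∈ B)
  have hTB : TB ≤ EB := by
    rw [Multiset.le_iff_subset (Multiset.Nodup.map_on ginj (B.erase v0).nodup)]
    intro e he
    obtain ⟨x, hx, rfl⟩ := Multiset.mem_map.1 he
    have hx := Finset.mem_erase.1 (Finset.mem_def.2 hx)
    obtain ⟨h1, h2, _⟩ := (H x hx.2).2 hx.1
    refine Multiset.mem_filter.2 ⟨h2, ?_⟩
    intro v hv
    simp only [g, Sym2.mem_iff] at hv
    rcases hv with rfl | rfl
    · exact hx.2
    · exact h1
  have hcard : 2 ≤ Multiset.card (EB - TB) := by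
    rw [Multiset.card_sub hTB]
    have h1 : Multiset.card TB = B.card - 1 := by
      simp only [TB, Multiset.card_map, Finset.card_val, Finset.card_erase_of_mem hv0]
    have h2 : B.card + 1 ≤ Multiset.card EB := h
    have h3 : 0 < B.card := Finset.card_pos.2 ⟨_, hv0⟩
    omega
  obtain ⟨Q, hQ, hQ2⟩ : ∃ Q ≤ EB - TB, Multiset.card Q = 2 := by
    obtain ⟨e, he⟩ := Multiset.card_pos_iff_exists_mem.1 (by omega : 0 < Multiset.card (EB - TB))
    obtain ⟨A, hA⟩ := Multiset.exists_cons_of_mem he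
    rw [hA] at hcard ⊢
    rw [Multiset.card_cons] at hcard
    obtain ⟨f, hf⟩ := Multiset.card_pos_iff_exists_mem.1 (by omega : 0 < Multiset.card A)
    exact ⟨e ::ₘ {f}, Multiset.cons_le_cons e (Multiset.singleton_le.2 hf), rfl⟩
  obtain ⟨e, f, rfl⟩ := Multiset.card_eq_two.1 hQ2
  have hQE : ({e, f} : Multiset (Sym2 V)) ≤ EB := hQ.trans (Multiset.sub_le_self _ _)
  have heB : ∀ v ∈ e, v ∈ B :=
    (Multiset.mem_filter.1 (Multiset.mem_of_le hQE (show e ∈ _ by simp))).2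
  have hfB : ∀ v ∈ f, v ∈ B :=
    (Multiset.mem_filter.1 (Multiset.mem_of_le hQE (show f ∈ _ by simp))).2
  obtain ⟨X, hX4, hXB, heX, hfX⟩ : ∃ X : Finset V, X.card ≤ 4 ∧ X ⊆ B ∧ (∀ v ∈ e, v ∈ X) ∧
      (∀ v ∈ f, v ∈ X) := by
    clear hQ hQ2 hQE
    induction e with
    | _ a b =>
      induction f with
      | _ a2 b2 =>
        refine ⟨{a, b, a2, b2}, Finset.card_le_four, ?_, ?_, ?_⟩
        · intro v hv
          simp only [Finset.mem_insert, Finset.mem_singleton] at hv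
          simp only [Sym2.mem_iff] at heB hfB
          grind
        · intro v hv
          simp only [Sym2.mem_iff] at hv
          simp only [Finset.mem_insert, Finset.mem_singleton]
          grind
        · intro v hv
          simp only [Sym2.mem_iff] at hv
          simp only [Finset.mem_insert, Finset.mem_singleton]
          grind
  let S : Finset V := insert v0 ((X ×ˢ Finset.range r).image (fun q => p^[q.2] q.1))
  have hSit : ∀ x ∈ X, ∀ i, p^[i] x ∈ S := by
    intro x hx i
    by_cases hi : i < r
    · exact Finset.mem_insert_of_mem (Finset.mem_image.2
        ⟨(x, i), Finset.mem_product.2 ⟨hx, Finset.mem_range.2 hi⟩, rfl⟩)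
    · rw [hend i (by omega) x (hXB hx)]
      exact Finset.mem_insert_self _ _
  have hv0S : v0 ∈ S := Finset.mem_insert_self _ _
  have hS : ∀ y ∈ S, y ∈ B ∧ p y ∈ S := by
    intro y hy
    rcases Finset.mem_insert.1 hy with rfl | hy
    · rw [hp0]; exact ⟨hv0, hv0S⟩
    · obtain ⟨⟨x, i⟩, hq, rfl⟩ := Finset.mem_image.1 hy
      have hx := (Finset.mem_product.1 hq).1
      refine ⟨(hit i x (hXB hx)).1, ?_⟩
      have := hSit x hx (i + 1)
      rwa [Function.iterate_succ_apply'] at this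
  refine ⟨S, ?_, ?_⟩
  · calc S.card ≤ _ + 1 := Finset.card_insert_le _ _
      _ ≤ (X ×ˢ Finset.range r).card + 1 := by gcongr; exact Finset.card_image_le
      _ ≤ 4 * r + 1 := by
        rw [Finset.card_product, Finset.card_range]; gcongr
  · let TS : Multiset (Sym2 V) := (S.erase v0).val.map g
    have hTS : TS ≤ TB := by
      apply Multiset.map_le_map
      rw [Finset.val_le_iff]
      exact Finset.erase_subset_erase _ (fun y hy => (hS y hy).1)
    have hle : TS + {e, f} ≤ E.filter (fun e => ∀ v ∈ e, v ∈ S) := by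
      rw [Multiset.le_filter]
      constructor
      · calc TS + {e, f} ≤ TB + (EB - TB) := add_le_add hTS hQ
          _ = EB := add_tsub_cancel_of_le hTB
          _ ≤ E := Multiset.filter_le _ _
      · intro z hz
        rcases Multiset.mem_add.1 hz with hz | hz
        · obtain ⟨x, hx, rfl⟩ := Multiset.mem_map.1 hz
          have hx := Finset.mem_erase.1 (Finset.mem_def.2 hx)
          intro v hv
          simp only [g, Sym2.mem_iff] at hv
          rcases hv with rfl | rfl
          · exact hx.2
          · exact (hS x hx.2).2
        · simp only [Multiset.insert_eq_cons, Multiset.mem_cons, Multiset.mem_singleton] at hz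
          rcases hz with rfl | rfl
          · exact fun v hv => hSit v (heX v hv) 0
          · exact fun v hv => hSit v (hfX v hv) 0
    have := Multiset.card_le_card hle
    have h1 : Multiset.card TS = S.card - 1 := by
      simp only [TS, Multiset.card_map, Finset.card_val, Finset.card_erase_of_mem hv0S]
    have h3 : 0 < S.card := Finset.card_pos.2 ⟨_, hv0S⟩
    rw [Multiset.card_add, h1, hQ2] at this
    unfold spn
    omega

lemma pow_bound (k R s : ℕ) (hk : 1 ≤ k) (hs : 2 ≤ s) (hR : (k : ℝ) * Real.logb 2 s ≤ R) :
    s * k ^ R ≤ (k + 1) ^ R := by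
  have hk0 : (0 : ℝ) < k := by exact_mod_cast hk
  have hs0 : (0 : ℝ) < s := by exact_mod_cast (by omega : 0 < s)
  have h1 : (2 : ℝ) ≤ (1 + 1 / k) ^ k := by
    have := one_add_mul_le_pow (a := (1 / k : ℝ)) (by have : (0:ℝ) < 1 / k := by positivity
                                                      linarith) k
    have h : (k : ℝ) * (1 / k) = 1 := by field_simp
    linarith
  have h2 : 1 ≤ (k : ℝ) * Real.logb 2 (1 + 1 / k) := by
    rw [← Real.logb_pow]
    rw [Real.le_logb_iff_rpow_le (by norm_num) (by positivity)]
    simpa using h1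
  have h3 : Real.logb 2 s ≤ R * Real.logb 2 (1 + 1 / k) := by
    have hR0 : (0 : ℝ) ≤ R := by positivity
    have : (k : ℝ) * Real.logb 2 s ≤ k * (R * Real.logb 2 (1 + 1 / k)) := by nlinarith
    exact le_of_mul_le_mul_left this hk0
  rw [← Real.logb_pow, Real.logb_le_logb (by norm_num) hs0 (by positivity)] at h3
  have h4 : (s : ℝ) * k ^ R ≤ (k + 1) ^ R := by
    calc (s : ℝ) * k ^ R ≤ (1 + 1 / k) ^ R * k ^ R := by gcongr
      _ = (k + 1) ^ R := by rw [← mul_pow]; congr 1; field_simp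
  exact_mod_cast h4

lemma main_aux {V : Type*} [Fintype V] (E : Multiset (Sym2 V)) (k R : ℕ) (hk : 1 ≤ k)
    (hs2 : 2 ≤ Fintype.card V) (hR : (k : ℝ) * Real.logb 2 (Fintype.card V) ≤ R)
    (hm : (k + 1) * Fintype.card V ≤ k * Multiset.card E) :
    ∃ S : Finset V, S.card ≤ 4 * R + 1 ∧ S.card + 1 ≤ spn E S := by
  obtain ⟨W, hW, hmin⟩ : ∃ W : Finset V, (W.Nonempty ∧ (k + 1) * W.card ≤ k * spn E W) ∧
      ∀ U, U ⊂ W → ¬ (U.Nonempty ∧ (k + 1) * U.card ≤ k * spn E U) := by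
    have hex : (Finset.univ : Finset V).Nonempty ∧
        (k + 1) * (Finset.univ : Finset V).card ≤ k * spn E Finset.univ := by
      constructor
      · rw [← Finset.card_pos, Finset.card_univ]; omega
      · simpa [spn] using hm
    obtain ⟨W, hW, hmin⟩ := WellFounded.has_min (wellFounded_lt (α := Finset V))
      {W | W.Nonempty ∧ (k + 1) * W.card ≤ k * spn E W} ⟨_, hex⟩
    exact ⟨W, hW, fun U hU h => hmin U h hU⟩
  obtain ⟨⟨v0, hv0⟩, hWk⟩ := hW
  by_cases hex : ∃ r ≤ R, (bll E W v0 r).card + 1 ≤ spn E (bll E W v0 r)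
  · obtain ⟨r, hr, h⟩ := hex
    obtain ⟨S, h1, h2⟩ := extract E W v0 r h
    exact ⟨S, by omega, h2⟩
  exfalso
  push Not at hex
  have hgrow : ∀ r, r ≤ R → (k + 1) ^ r ≤ k ^ r * (bll E W v0 r).card := by
    intro r
    induction r with
    | zero => intro _; simp [bll]
    | succ r ih =>
      intro hr
      have h1 := ih (by omega)
      have h2 := hex (r + 1) hr
      have h3 := spn_touch E W v0 hv0 r
      have hsub := bll_sub E W v0 hv0 r
      have hmem : v0 ∈ bll E W v0 r := bll_mono E W v0 (Nat.zero_le r) (by simp [bll])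
      have h4 : k * spn E (W \ bll E W v0 r) ≤ (k + 1) * (W \ bll E W v0 r).card := by
        rcases Finset.eq_empty_or_nonempty (W \ bll E W v0 r) with he | hne
        · rw [he, spn_empty]; simp
        · have := hmin _ (Finset.sdiff_ssubset hsub ⟨_, hmem⟩)
          by_contra hc
          exact this ⟨hne, by omega⟩
      have h5 := Finset.card_sdiff_add_card_eq_card hsub
      have h6 : (k + 1) * (bll E W v0 r).card ≤ k * (bll E W v0 (r + 1)).card := by
        rw [← h5] at hWk
        have h7 := Nat.mul_le_mul_left k h3
        have h8 := Nat.mul_le_mul_left k (Nat.lt_succ_iff.1 h2)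
        rw [mul_add] at hWk h7
        omega
      calc (k + 1) ^ (r + 1) = (k + 1) * (k + 1) ^ r := by ring
        _ ≤ (k + 1) * (k ^ r * (bll E W v0 r).card) := Nat.mul_le_mul_left _ h1
        _ = k ^ r * ((k + 1) * (bll E W v0 r).card) := by ring
        _ ≤ k ^ r * (k * (bll E W v0 (r + 1)).card) := Nat.mul_le_mul_left _ h6
        _ = _ := by ring
  have h1 := hgrow R le_rfl
  have h2 := pow_bound k R _ hk hs2 hR
  have h3 : Fintype.card V ≤ (bll E W v0 R).card := by
    have : k ^ R * Fintype.card V ≤ k ^ R * (bll E W v0 R).card := by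
      rw [mul_comm _ (Fintype.card V)]; exact h2.trans h1
    exact Nat.le_of_mul_le_mul_left this (by positivity)
  have h4 : bll E W v0 R = W :=
    Finset.eq_of_subset_of_card_le (bll_sub E W v0 hv0 R) ((Finset.card_le_univ W).trans h3)
  have h5 := hex R le_rfl
  rw [h4] at h5
  have h6 := Nat.mul_le_mul_left k (Nat.lt_succ_iff.1 h5)
  have h7 : 0 < W.card := Finset.card_pos.2 ⟨_, hv0⟩
  rw [add_mul] at hWk
  omega

/-- Every multigraph with `s ≥ 2` vertices and `m ≥ s(1+ε)` edges
(edges given as a multiset of unordered pairs, allowing parallel edges and self-loops)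
contains a vertex set `S` with `|S| ≤ 8·log₂(s)·⌈1/ε⌉` spanning at least `|S| + 1` edges. -/
theorem stmt_0 (V : Type*) [Fintype V] (E : Multiset (Sym2 V)) (s m : ℕ) (ε : ℝ)
    (hs : Fintype.card V = s) (hs2 : 2 ≤ s) (hm : Multiset.card E = m)
    (hε0 : 0 < ε) (hε1 : ε ≤ 1) (hme : (m : ℝ) ≥ s * (1 + ε)) :
    ∃ S : Finset V, (S.card : ℝ) ≤ 8 * Real.logb 2 s * (⌈1 / ε⌉ : ℝ) ∧
      S.card + 1 ≤ Multiset.card (E.filter (fun e => ∀ v ∈ e, v ∈ S)) := by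
  have hpos : 0 < ⌈1 / ε⌉ := Int.ceil_pos.2 (by positivity)
  obtain ⟨k, hk⟩ := Int.eq_ofNat_of_zero_le hpos.le
  have hk1 : 1 ≤ k := by omega
  have hkr : (⌈1 / ε⌉ : ℝ) = k := by rw [hk]; simp
  have hke : 1 / ε ≤ k := by rw [← hkr]; exact Int.le_ceil _
  rw [hkr]
  have hk1r : (1 : ℝ) ≤ k := by exact_mod_cast hk1
  have hs2r : (2 : ℝ) ≤ s := by exact_mod_cast hs2
  by_cases h2 : s = 2
  · subst h2
    refine ⟨Finset.univ, ?_, ?_⟩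
    · rw [Finset.card_univ, hs]
      have : Real.logb 2 ((2 : ℕ) : ℝ) = 1 := by
        push_cast; exact Real.logb_self_eq_one (by norm_num)
      rw [this]; push_cast; linarith
    · rw [Finset.card_univ, hs]
      simp only [Finset.mem_univ, implies_true, Multiset.filter_true, hm]
      have : (2 : ℝ) < m := by push_cast at hme; linarith
      exact_mod_cast this
  have hL : (5 / 4 : ℝ) ≤ Real.logb 2 s := by
    have h3 : (3 : ℝ) ≤ s := by exact_mod_cast (by omega : 3 ≤ s)
    have : (5 : ℝ) ≤ 4 * Real.logb 2 s := by
      rw [show (4 : ℝ) = ((4 : ℕ) : ℝ) by norm_num, ← Real.logb_pow,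
        Real.le_logb_iff_rpow_le (by norm_num) (by positivity)]
      calc (2 : ℝ) ^ (5 : ℝ) = 32 := by norm_num
        _ ≤ 3 ^ 4 := by norm_num
        _ ≤ (s : ℝ) ^ 4 := by gcongr
    linarith
  have hkm : (k + 1) * Fintype.card V ≤ k * Multiset.card E := by
    rw [hs, hm]
    have h1 : 1 ≤ (k : ℝ) * ε := by rwa [div_le_iff₀ hε0] at hke
    have : ((k : ℝ) + 1) * s ≤ k * m := by nlinarith
    exact_mod_cast this
  obtain ⟨S, h1, h3⟩ := main_aux E k ⌈(k : ℝ) * Real.logb 2 s⌉₊ hk1 (by omega)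
    (by rw [hs]; exact Nat.le_ceil _) hkm
  refine ⟨S, ?_, by unfold spn at h3; convert h3⟩
  have h4 := Nat.ceil_lt_add_one (a := (k : ℝ) * Real.logb 2 s) (by positivity)
  have h5 : (S.card : ℝ) ≤ 4 * (⌈(k : ℝ) * Real.logb 2 s⌉₊ : ℝ) + 1 := by exact_mod_cast h1
  have h6 : (5 / 4 : ℝ) ≤ k * Real.logb 2 s := by nlinarith
  linarith
end

section
/- Let 𝔽 be a finite field, let t ≥ 3 be an integer, and let f : 𝔽ⁿ → 𝔽ᵐ be (k+1)-wise independent for some integer k with k ≥ 2^{t+2}·log₂(s) and k ≤ s. Suppose there is a non-adaptive static data structure for f with space s ≥ 2 and query time t; that is, there are a preprocessing map P : 𝔽ⁿ → 𝔽ˢ and, for each query i ∈ {1,…,m}, a set S_i ⊆ {1,…,s} of at most t memory cells and a function Q_i : (S_i → 𝔽) → 𝔽 such that f(x)_i = Q_i(P(x) restricted to S_i) for all x ∈ 𝔽ⁿ and all i. Then m < 3s·((2^{t+3}·s·log₂(s))/k)^{t-2}; equivalently, s ≥ (m/3)^{1/(t-1)}·(k/(2^{t+3}·log₂(s)))^{(t-2)/(t-1)}.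 -/
open scoped Classical

/-- Rooted tree system used in the breadth first search. -/
def BfsInv {ι α : Type*} [DecidableEq α] (E : ι → Finset α) (I : Finset ι)
    (X : Finset α) (root : α) (r : ℕ) (W : Finset α) (p : α → ι) : Prop :=
  root ∈ W ∧ W ⊆ X ∧ (∀ w ∈ W, w ≠ root → p w ∈ I) ∧
  (∀ w ∈ W, w ≠ root → ∀ w' ∈ W, w' ≠ root → p w = p w' → w = w') ∧
  ∀ w ∈ W, ∃ D ⊆ W, root ∈ D ∧ w ∈ D ∧ D.card ≤ r + 1 ∧ ∀ d ∈ D, d ≠ root → E (p d) ⊆ D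

lemma bfs_finish {ι α : Type*} [DecidableEq ι] [DecidableEq α] (E : ι → Finset α)
    (I : Finset ι) (hE : ∀ i ∈ I, (E i).card ≤ 2)
    (X : Finset α) (root : α) (r : ℕ) (W : Finset α) (p : α → ι)
    (h : BfsInv E I X root r W p) (M : Finset ι) (hMI : M ⊆ I)
    (hMW : ∀ i ∈ M, E i ⊆ W) (hMne : ∀ i ∈ M, (E i).Nonempty) (hM : W.card + 1 ≤ M.card) :
    ∃ J ⊆ I, J.card ≤ 4 * r + 5 ∧ (J.biUnion E).card < J.card := by
  obtain ⟨hrW, hWX, hpI, hpinj, hD⟩ := h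
  have h1 : 2 ≤ (M \ (W.erase root).image p).card := by
    have := Finset.le_card_sdiff ((W.erase root).image p) M
    have h2 : ((W.erase root).image p).card ≤ (W.erase root).card := Finset.card_image_le
    rw [Finset.card_erase_of_mem hrW] at h2
    have : 0 < W.card := Finset.card_pos.2 ⟨_, hrW⟩
    omega
  obtain ⟨e1, he1, e2, he2, hne⟩ := Finset.one_lt_card.1 h1
  rw [Finset.mem_sdiff] at he1 he2
  choose! D hDW hDr hDm hDc hDp using hD
  have hS : E e1 ∪ E e2 ⊆ W := Finset.union_subset (hMW _ he1.1) (hMW _ he2.1)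
  set S := E e1 ∪ E e2 with hSdef
  have hSc : S.card ≤ 4 := by
    have := Finset.card_union_le (E e1) (E e2)
    have := hE e1 (hMI he1.1)
    have := hE e2 (hMI he2.1)
    rw [hSdef]
    omega
  set U := S.biUnion D with hU
  have hUW : U ⊆ W := by
    intro x hx
    obtain ⟨v, hv, hx⟩ := Finset.mem_biUnion.1 hx
    exact hDW v (hS hv) hx
  have hSU : S ⊆ U := fun v hv => Finset.mem_biUnion.2 ⟨v, hv, hDm v (hS hv)⟩
  have hrU : root ∈ U := by
    obtain ⟨v, hv⟩ := hMne e1 he1.1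
    have hv : v ∈ S := Finset.mem_union_left _ hv
    exact Finset.mem_biUnion.2 ⟨v, hv, hDr v (hS hv)⟩
  have hUc : U.card ≤ 4 * (r + 1) := by
    calc U.card ≤ S.card * (r + 1) :=
          Finset.card_biUnion_le_card_mul _ _ _ (fun v hv => hDc v (hS hv))
      _ ≤ 4 * (r + 1) := Nat.mul_le_mul_right _ hSc
  have hpc : ((U.erase root).image p).card = U.card - 1 := by
    rw [Finset.card_image_of_injOn, Finset.card_erase_of_mem hrU]
    intro a ha b hb hab
    simp only [Finset.coe_erase, Set.mem_sdiff, Finset.mem_coe, Set.mem_singleton_iff] at ha hb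
    exact hpinj a (hUW ha.1) ha.2 b (hUW hb.1) hb.2 hab
  have hsub : (U.erase root).image p ⊆ (W.erase root).image p :=
    Finset.image_subset_image (Finset.erase_subset_erase _ hUW)
  have hUpos : 0 < U.card := Finset.card_pos.2 ⟨_, hrU⟩
  have hJc : (insert e1 (insert e2 ((U.erase root).image p))).card = U.card + 1 := by
    rw [Finset.card_insert_of_notMem, Finset.card_insert_of_notMem, hpc]
    · omega
    · exact fun h => he2.2 (hsub h)
    · intro h
      rcases Finset.mem_insert.1 h with h | h
      · exact hne h
      · exact he1.2 (hsub h)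
  refine ⟨insert e1 (insert e2 ((U.erase root).image p)), ?_, ?_, ?_⟩
  · intro x hx
    rcases Finset.mem_insert.1 hx with rfl | hx
    · exact hMI he1.1
    rcases Finset.mem_insert.1 hx with rfl | hx
    · exact hMI he2.1
    obtain ⟨w, hw, rfl⟩ := Finset.mem_image.1 hx
    rw [Finset.mem_erase] at hw
    exact hpI w (hUW hw.2) hw.1
  · omega
  · rw [hJc]
    refine Nat.lt_succ_of_le (Finset.card_le_card ?_)
    intro x hx
    obtain ⟨j, hj, hxj⟩ := Finset.mem_biUnion.1 hx
    rcases Finset.mem_insert.1 hj with rfl | hj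
    · exact hSU (Finset.mem_union_left _ hxj)
    rcases Finset.mem_insert.1 hj with rfl | hj
    · exact hSU (Finset.mem_union_right _ hxj)
    obtain ⟨w, hw, rfl⟩ := Finset.mem_image.1 hj
    rw [Finset.mem_erase] at hw
    obtain ⟨v, hv, hwv⟩ := Finset.mem_biUnion.1 hw.2
    exact Finset.mem_biUnion.2 ⟨v, hv, hDp v (hS hv) w hwv hw.1 hxj⟩

lemma bfs_extend {ι α : Type*} [DecidableEq ι] [DecidableEq α] (E : ι → Finset α)
    (I : Finset ι) (hE : ∀ i ∈ I, (E i).card ≤ 2)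
    (X : Finset α) (root : α) (r : ℕ) (W : Finset α) (p : α → ι)
    (h : BfsInv E I X root r W p) (M : Finset ι) (hMI : M ⊆ I)
    (hMX : ∀ i ∈ M, E i ⊆ X) (hMW : ∀ i ∈ M, ∃ u ∈ E i, u ∈ W) :
    ∃ p', BfsInv E I X root (r + 1) (W ∪ M.biUnion E) p' := by
  obtain ⟨hrW, hWX, hpI, hpinj, hD⟩ := h
  have hsel : ∀ w, w ∈ W ∪ M.biUnion E → w ∉ W →
      ∃ i ∈ M, ∃ u ∈ W, E i = {u, w} := by
    intro w hw hwW
    rcases Finset.mem_union.1 hw with hw | hw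
    · exact absurd hw hwW
    obtain ⟨i, hi, hwi⟩ := Finset.mem_biUnion.1 hw
    obtain ⟨u, hui, huW⟩ := hMW i hi
    refine ⟨i, hi, u, huW, ?_⟩
    symm
    apply Finset.eq_of_subset_of_card_le
    · intro x hx
      simp only [Finset.mem_insert, Finset.mem_singleton] at hx
      rcases hx with rfl | rfl <;> assumption
    · rw [Finset.card_pair]
      · exact hE i (hMI hi)
      · rintro rfl; exact hwW huW
  have hold : ∀ w ∈ W, w ≠ root → E (p w) ⊆ W := by
    intro w hw hwr
    obtain ⟨D, hDW, -, hwD, -, hDp⟩ := hD w hw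
    exact (hDp w hwD hwr).trans hDW
  have : Nonempty ι := ⟨p root⟩
  choose! q hqM u huW hqE using hsel
  refine ⟨fun w => if w ∈ W then p w else q w, Finset.mem_union_left _ hrW, ?_, ?_, ?_, ?_⟩
  · refine Finset.union_subset hWX (fun x hx => ?_)
    obtain ⟨i, hi, hx⟩ := Finset.mem_biUnion.1 hx
    exact hMX i hi hx
  · intro w hw hwr
    by_cases hwW : w ∈ W
    · simpa [hwW] using hpI w hwW hwr
    · simpa [hwW] using hMI (hqM w hw hwW)
  · intro w hw hwr w' hw' hwr' heq
    by_cases hwW : w ∈ W <;> by_cases hwW' : w' ∈ W <;> simp only [hwW, hwW', if_true, if_false] at heq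
    · exact hpinj w hwW hwr w' hwW' hwr' heq
    · exfalso
      apply hwW'
      apply hold w hwW hwr
      rw [heq, hqE w' hw' hwW']; simp
    · exfalso
      apply hwW
      apply hold w' hwW' hwr'
      rw [← heq, hqE w hw hwW]; simp
    · have h1 := hqE w hw hwW
      rw [heq, hqE w' hw' hwW'] at h1
      have h2 : w ∈ ({u w', w'} : Finset α) := by rw [h1]; simp
      simp only [Finset.mem_insert, Finset.mem_singleton] at h2
      rcases h2 with h2 | h2
      · exact absurd (h2 ▸ huW w' hw' hwW') hwW
      · exact h2
  · intro w hw
    by_cases hwW : w ∈ W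
    · obtain ⟨D, hDW, hr, hwD, hc, hDp⟩ := hD w hwW
      refine ⟨D, hDW.trans Finset.subset_union_left, hr, hwD, by omega, ?_⟩
      intro d hd hdr
      simpa [hDW hd] using hDp d hd hdr
    · obtain ⟨D, hDW, hr, hwD, hc, hDp⟩ := hD (u w) (huW w hw hwW)
      refine ⟨insert w D, ?_, Finset.mem_insert_of_mem hr, Finset.mem_insert_self _ _, ?_, ?_⟩
      · exact Finset.insert_subset hw (hDW.trans Finset.subset_union_left)
      · have := Finset.card_insert_le w D
        omega
      · intro d hd hdr
        rcases Finset.mem_insert.1 hd with rfl | hd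
        · simp only [hwW, if_false, hqE d hw hwW]
          intro x hx
          simp only [Finset.mem_insert, Finset.mem_singleton] at hx ⊢
          rcases hx with rfl | rfl
          · exact Or.inr hwD
          · exact Or.inl rfl
        · simp only [hDW hd, if_true]
          exact (hDp d hd hdr).trans (Finset.subset_insert _ _)

lemma dense_step {ι : Type*} [DecidableEq ι] (s : ℕ) (hs : 1 ≤ s) (E : ι → Finset (Fin s))
    (I : Finset ι) (hE : ∀ i ∈ I, (E i).card ≤ 2) (hI : 2 * s ≤ I.card) :
    ∃ J ⊆ I, J.card ≤ 4 * Nat.log 2 s + 9 ∧ (J.biUnion E).card < J.card := by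
  by_cases hemp : ∃ i ∈ I, E i = ∅
  · obtain ⟨i, hi, h⟩ := hemp
    exact ⟨{i}, by simpa using hi, by simp, by simp [h]⟩
  have hne : ∀ i ∈ I, (E i).Nonempty := by
    intro i hi
    rw [Finset.nonempty_iff_ne_empty]
    exact fun h => hemp ⟨i, hi, h⟩
  -- minimal dense vertex set
  let good : Finset (Fin s) → Prop := fun X =>
    X.Nonempty ∧ 2 * X.card ≤ (I.filter (fun i => E i ⊆ X)).card
  have hgood : good Finset.univ := by
    have : Nonempty (Fin s) := ⟨⟨0, hs⟩⟩
    refine ⟨Finset.univ_nonempty, ?_⟩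
    simpa using hI
  obtain ⟨X, hX, hmin⟩ : ∃ X, good X ∧ ∀ Y, Y ⊂ X → ¬ good Y := by
    obtain ⟨X, hX⟩ := (Set.toFinite {X | good X}).exists_minimal ⟨_, hgood⟩
    exact ⟨X, hX.1, fun Y hY hg => hY.2 (hX.2 hg hY.1)⟩
  have htouch : ∀ W ⊆ X, W.Nonempty →
      2 * W.card ≤ (I.filter (fun i => E i ⊆ X ∧ ¬ Disjoint (E i) W)).card := by
    intro W hWX hW
    have hsplit : (I.filter (fun i => E i ⊆ X)).card =
        (I.filter (fun i => E i ⊆ X ∧ ¬ Disjoint (E i) W)).card +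
        (I.filter (fun i => E i ⊆ X \ W)).card := by
      rw [← Finset.card_filter_add_card_filter_not (s := I.filter (fun i => E i ⊆ X))
        (fun i => ¬ Disjoint (E i) W), Finset.filter_filter, Finset.filter_filter]
      simp only [not_not, Finset.subset_sdiff]
    have hcard := Finset.card_sdiff_add_card_eq_card hWX
    have h2 := hX.2
    by_cases hXW : (X \ W).Nonempty
    · have := hmin (X \ W) (Finset.sdiff_ssubset hWX hW)
      have : ¬ (2 * (X \ W).card ≤ (I.filter (fun i => E i ⊆ X \ W)).card) :=
        fun h => this ⟨hXW, h⟩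
      omega
    · rw [Finset.not_nonempty_iff_eq_empty] at hXW
      have : I.filter (fun i => E i ⊆ X \ W) = ∅ := by
        rw [Finset.filter_eq_empty_iff]
        intro i hi h
        rw [hXW, Finset.subset_empty] at h
        exact hemp ⟨i, hi, h⟩
      rw [this, Finset.card_empty] at hsplit
      rw [hXW, Finset.card_empty] at hcard
      omega
  obtain ⟨root, hroot⟩ := hX.1
  have hmain : ∀ r, (∃ J ⊆ I, J.card ≤ 4 * r + 5 ∧ (J.biUnion E).card < J.card) ∨
      ∃ W p, BfsInv E I X root r W p ∧ 2 ^ r ≤ W.card := by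
    intro r
    induction r with
    | zero =>
      right
      have : I.Nonempty := by
        rw [← Finset.card_pos]; omega
      obtain ⟨i, -⟩ := this
      refine ⟨{root}, fun _ => i, ⟨by simp, by simpa using hroot, ?_, ?_, ?_⟩, by simp⟩
      · intro w hw h; exact absurd (Finset.mem_singleton.1 hw) h
      · intro w hw h; exact absurd (Finset.mem_singleton.1 hw) h
      · intro w hw
        refine ⟨{root}, by simp, by simp, hw, by simp, ?_⟩
        intro d hd h; exact absurd (Finset.mem_singleton.1 hd) h
    | succ r ih =>
      rcases ih with ⟨J, hJ, hc, hlt⟩ | ⟨W, p, hinv, hW⟩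
      · exact Or.inl ⟨J, hJ, by omega, hlt⟩
      have hWX := hinv.2.1
      have ht := htouch W hWX ⟨_, hinv.1⟩
      set M := I.filter (fun i => E i ⊆ X ∧ ¬ Disjoint (E i) W) with hM
      have hMI : M ⊆ I := Finset.filter_subset _ _
      obtain ⟨p', hp'⟩ := bfs_extend E I hE X root r W p hinv M hMI
        (fun i hi => (Finset.mem_filter.1 hi).2.1)
        (fun i hi => Finset.not_disjoint_iff.1 (Finset.mem_filter.1 hi).2.2)
      by_cases hbig : 2 * W.card ≤ (W ∪ M.biUnion E).card
      · right
        refine ⟨_, p', hp', ?_⟩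
        rw [pow_succ]; omega
      · left
        refine bfs_finish E I hE X root (r + 1) _ p' hp' M hMI ?_
          (fun i hi => hne i (hMI hi)) (by omega)
        intro i hi
        exact (Finset.subset_biUnion_of_mem E hi).trans Finset.subset_union_right
  rcases hmain (Nat.log 2 s + 1) with ⟨J, hJ, hc, hlt⟩ | ⟨W, p, -, hW⟩
  · exact ⟨J, hJ, by omega, hlt⟩
  · exfalso
    have h1 : W.card ≤ s := by simpa using Finset.card_le_univ W
    have h2 := Nat.lt_pow_succ_log_self (b := 2) (by norm_num) s
    rw [Nat.succ_eq_add_one] at h2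
    omega

lemma dense_iter {ι : Type*} [DecidableEq ι] (s : ℕ) (hs : 1 ≤ s) (E : ι → Finset (Fin s))
    (I : Finset ι) (hE : ∀ i ∈ I, (E i).card ≤ 2) (r : ℕ)
    (hI : 2 * s + r * (4 * Nat.log 2 s + 9) ≤ I.card) :
    ∃ J ⊆ I, J.card ≤ r * (4 * Nat.log 2 s + 9) ∧ (J.biUnion E).card + r ≤ J.card := by
  induction r with
  | zero => exact ⟨∅, by simp, by simp, by simp⟩
  | succ r ih =>
    have hmul : (r + 1) * (4 * Nat.log 2 s + 9) =
        r * (4 * Nat.log 2 s + 9) + (4 * Nat.log 2 s + 9) := Nat.succ_mul _ _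
    rw [hmul] at hI ⊢
    obtain ⟨J, hJ, hc, hr⟩ := ih (by omega)
    obtain ⟨K, hK, hKc, hKr⟩ := dense_step s hs (fun i => E i \ J.biUnion E) (I \ J)
      (fun i hi => (Finset.card_le_card Finset.sdiff_subset).trans
        (hE i (Finset.mem_sdiff.1 hi).1))
      (by have := Finset.card_sdiff_add_card_eq_card hJ; omega)
    have hdisj : Disjoint J K := by
      rw [Finset.disjoint_right]
      intro x hx; exact (Finset.mem_sdiff.1 (hK hx)).2
    refine ⟨J ∪ K, Finset.union_subset hJ (hK.trans Finset.sdiff_subset), ?_, ?_⟩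
    · rw [Finset.card_union_of_disjoint hdisj]; omega
    · rw [Finset.card_union_of_disjoint hdisj]
      have : (J ∪ K).biUnion E ⊆ J.biUnion E ∪ K.biUnion (fun i => E i \ J.biUnion E) := by
        intro x hx
        by_cases hxJ : x ∈ J.biUnion E
        · exact Finset.mem_union_left _ hxJ
        obtain ⟨i, hi, hxi⟩ := Finset.mem_biUnion.1 hx
        rcases Finset.mem_union.1 hi with hi | hi
        · exact absurd (Finset.mem_biUnion.2 ⟨i, hi, hxi⟩) hxJ
        · exact Finset.mem_union_right _
            (Finset.mem_biUnion.2 ⟨i, hi, Finset.mem_sdiff.2 ⟨hxi, hxJ⟩⟩)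
      have h1 := Finset.card_le_card this
      have h2 := Finset.card_union_le (J.biUnion E) (K.biUnion (fun i => E i \ J.biUnion E))
      omega

/-- Independence forces queries to touch many cells. -/
lemma indep_cover (F : Type*) [Field F] [Fintype F] (n m s k : ℕ)
    (f : (Fin n → F) → (Fin m → F))
    (hf : ∀ T : Finset (Fin m), T.card = k + 1 → ∀ y : T → F,
      (Finset.univ.filter (fun x : Fin n → F => ∀ i : T, f x i = y i)).card =
        Fintype.card F ^ (n - (k + 1)))
    (P : (Fin n → F) → (Fin s → F))
    (Sq : Fin m → Finset (Fin s))
    (Q : ∀ i : Fin m, (↥(Sq i) → F) → F)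
    (hQ : ∀ (x : Fin n → F) (i : Fin m), f x i = Q i (fun j : ↥(Sq i) => P x ↑j))
    (hm : k + 1 ≤ m) (J : Finset (Fin m)) (hJ : J.card ≤ k + 1) :
    J.card ≤ (J.biUnion Sq).card := by
  obtain ⟨T, hJT, hT⟩ := Finset.exists_superset_card_eq hJ (by simpa using hm)
  have hsurj : ∀ y : J → F, ∃ x, ∀ i : J, f x i = y i := by
    intro y
    have h := hf T hT (fun i => if h : (i : Fin m) ∈ J then y ⟨i, h⟩ else 0)
    have hpos : 0 < Fintype.card F ^ (n - (k + 1)) := pow_pos Fintype.card_pos _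
    rw [← h, Finset.card_pos] at hpos
    obtain ⟨x, hx⟩ := hpos
    refine ⟨x, fun i => ?_⟩
    have := (Finset.mem_filter.1 hx).2 ⟨i, hJT i.2⟩
    simpa using this
  let g : (↥(J.biUnion Sq) → F) → (J → F) := fun z i =>
    Q i (fun j => z ⟨j, Finset.mem_biUnion.2 ⟨i, i.2, j.2⟩⟩)
  have hg : Function.Surjective g := by
    intro y
    obtain ⟨x, hx⟩ := hsurj y
    refine ⟨fun j => P x j, funext fun i => ?_⟩
    rw [← hx i, hQ]
  have := Fintype.card_le_of_surjective g hg
  simp only [Fintype.card_fun, Fintype.card_coe] at this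
  exact (Nat.pow_le_pow_iff_right Fintype.one_lt_card).1 this

lemma exists_blocks (s t a : ℕ) (ht : 3 ≤ t) (S : Finset (Fin s)) (hS : S.card ≤ t) :
    ∃ c : Fin (t - 2) → Fin (s / a + 1),
      (S.filter (fun v : Fin s => ∀ j, (c j : ℕ) ≠ (v : ℕ) / a)).card ≤ 2 := by
  obtain ⟨D, hDS, hD⟩ := Finset.exists_subset_card_eq (s := S) (n := S.card - 2) (by omega)
  have hemb : Nonempty (D ↪ Fin (t - 2)) := by
    apply Function.Embedding.nonempty_of_card_le
    simp only [Fintype.card_coe, Fintype.card_fin]; omega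
  obtain ⟨e⟩ := hemb
  refine ⟨fun j => if h : ∃ d, e d = j then
    ⟨(h.choose : Fin s).1 / a, Nat.lt_succ_of_le (Nat.div_le_div_right (Fin.is_lt _).le)⟩ else 0, ?_⟩
  calc _ ≤ (S \ D).card := by
        apply Finset.card_le_card
        intro v hv
        rw [Finset.mem_filter] at hv
        refine Finset.mem_sdiff.2 ⟨hv.1, fun hvD => ?_⟩
        have hex : ∃ d, e d = e ⟨v, hvD⟩ := ⟨_, rfl⟩
        apply hv.2 (e ⟨v, hvD⟩)
        have h2 : hex.choose = ⟨v, hvD⟩ := e.injective hex.choose_spec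
        beta_reduce
        rw [dif_pos hex]
        simp only [h2]
    _ ≤ 2 := by
        have := Finset.card_sdiff_add_card_eq_card hDS
        omega

lemma block_card (s N a : ℕ) (ha : 0 < a) (c : Fin N → Fin (s / a + 1)) :
    (Finset.univ.filter (fun v : Fin s => ∃ j, (c j : ℕ) = (v : ℕ) / a)).card ≤ N * a := by
  calc _ ≤ ((Finset.univ : Finset (Fin N)).biUnion
        (fun j => Finset.univ.filter (fun v : Fin s => (c j : ℕ) = (v : ℕ) / a))).card := by
        apply Finset.card_le_card
        intro v hv
        obtain ⟨j, hj⟩ := (Finset.mem_filter.1 hv).2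
        exact Finset.mem_biUnion.2 ⟨j, Finset.mem_univ _, by simp [hj]⟩
    _ ≤ (Finset.univ : Finset (Fin N)).card * a := by
        apply Finset.card_biUnion_le_card_mul
        intro j _
        rw [← Finset.card_map Fin.valEmbedding]
        calc _ ≤ (Finset.Ico ((c j : ℕ) * a) ((c j : ℕ) * a + a)).card := by
              apply Finset.card_le_card
              intro x hx
              obtain ⟨v, hv, rfl⟩ := Finset.mem_map.1 hx
              have hv := (Finset.mem_filter.1 hv).2
              rw [Finset.mem_Ico, hv]
              have h1 := Nat.div_add_mod (v : ℕ) a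
              have h2 := Nat.mod_lt (v : ℕ) ha
              rw [mul_comm] at h1
              simp only [Fin.valEmbedding_apply]
              omega
          _ = a := by simp
    _ = N * a := by simp

/-- The combinatorial core. -/
lemma core (F : Type*) [Field F] [Fintype F] (n m s k t a : ℕ) (ht : 3 ≤ t)
    (hs : 2 ≤ s) (ha : 0 < a)
    (f : (Fin n → F) → (Fin m → F))
    (hf : ∀ T : Finset (Fin m), T.card = k + 1 → ∀ y : T → F,
      (Finset.univ.filter (fun x : Fin n → F => ∀ i : T, f x i = y i)).card =
        Fintype.card F ^ (n - (k + 1)))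
    (hk2 : k ≤ s)
    (P : (Fin n → F) → (Fin s → F))
    (Sq : Fin m → Finset (Fin s)) (hSq : ∀ i, (Sq i).card ≤ t)
    (Q : ∀ i : Fin m, (↥(Sq i) → F) → F)
    (hQ : ∀ (x : Fin n → F) (i : Fin m), f x i = Q i (fun j : ↥(Sq i) => P x ↑j))
    (hak : ((t - 2) * a + 1) * (4 * Nat.log 2 s + 9) ≤ k)
    (hm : (s / a + 1) ^ (t - 2) * (3 * s) ≤ m) : False := by
  choose c hc using fun i => exists_blocks s t a ht (Sq i) (hSq i)
  obtain ⟨b, -, hb⟩ := Finset.exists_le_card_fiber_of_mul_le_card_of_maps_to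
    (s := (Finset.univ : Finset (Fin m)))
    (t := (Finset.univ : Finset (Fin (t - 2) → Fin (s / a + 1)))) (f := c) (n := 3 * s)
    (fun i _ => Finset.mem_univ _) Finset.univ_nonempty (by simpa using hm)
  set I := Finset.univ.filter (fun i => c i = b) with hI
  set A := Finset.univ.filter (fun v : Fin s => ∃ j, (b j : ℕ) = (v : ℕ) / a) with hA
  have hAc : A.card ≤ (t - 2) * a := block_card s (t - 2) a ha b
  have hL : (A.card + 1) * (4 * Nat.log 2 s + 9) ≤ k :=
    (Nat.mul_le_mul_right _ (by omega)).trans hak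
  obtain ⟨J, hJI, hJc, hJ⟩ := dense_iter s (by omega) (fun i => Sq i \ A) I (by
    intro i hi
    have hi : c i = b := (Finset.mem_filter.1 hi).2
    refine le_trans (Finset.card_le_card ?_) (hc i)
    intro v hv
    rw [Finset.mem_sdiff] at hv
    refine Finset.mem_filter.2 ⟨hv.1, fun j hj => hv.2 ?_⟩
    rw [hi] at hj
    exact Finset.mem_filter.2 ⟨Finset.mem_univ _, j, hj⟩) (A.card + 1) (by omega)
  have hmk : k + 1 ≤ m := by
    have h1 : 1 ≤ (s / a + 1) ^ (t - 2) := Nat.one_le_pow _ _ (Nat.succ_pos _)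
    have := Nat.mul_le_mul_right (3 * s) h1
    omega
  have h1 := indep_cover F n m s k f hf P Sq Q hQ hmk J (by omega)
  have h2 : J.biUnion Sq ⊆ J.biUnion (fun i => Sq i \ A) ∪ A := by
    intro x hx
    by_cases hxA : x ∈ A
    · exact Finset.mem_union_right _ hxA
    obtain ⟨i, hi, hxi⟩ := Finset.mem_biUnion.1 hx
    exact Finset.mem_union_left _ (Finset.mem_biUnion.2 ⟨i, hi, Finset.mem_sdiff.2 ⟨hxi, hxA⟩⟩)
  have h3 := Finset.card_le_card h2
  have h4 := Finset.card_union_le (J.biUnion (fun i => Sq i \ A)) A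
  omega

lemma pow_aux (t : ℕ) (ht : 3 ≤ t) : 10 * (2 * t - 3) ≤ 2 ^ (t + 2) := by
  induction t, ht using Nat.le_induction with
  | base => norm_num
  | succ t ht ih =>
    have : 2 ^ (t + 1 + 2) = 2 * 2 ^ (t + 2) := by ring
    have h2 : 20 ≤ 2 ^ (t + 2) := by
      calc 20 ≤ 2 ^ 5 := by norm_num
        _ ≤ 2 ^ (t + 2) := Nat.pow_le_pow_right (by norm_num) (by omega)
    omega



/-- Let `𝔽` be a finite field, `t ≥ 3`, and `f : 𝔽ⁿ → 𝔽ᵐ` be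
`(k+1)`-wise independent with `2^{t+2}·log₂ s ≤ k ≤ s`. If there is a non-adaptive static
data structure for `f` with space `s ≥ 2` and query time `t` (a preprocessing map
`P : 𝔽ⁿ → 𝔽ˢ`, and for each query `i` a set `Sq i` of at most `t` cells and a map `Q i`
with `f(x)_i = Q i (P(x)|_{Sq i})`), then `m < 3s·((2^{t+3}·s·log₂ s)/k)^{t-2}`;
equivalently, `s ≥ (m/3)^{1/(t-1)}·(k/(2^{t+3}·log₂ s))^{(t-2)/(t-1)}`. -/
theorem stmt_8 (F : Type*) [Field F] [Fintype F] (n m s k t : ℕ) (ht : 3 ≤ t)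
    (hs : 2 ≤ s)
    (f : (Fin n → F) → (Fin m → F))
    (hf : ∀ T : Finset (Fin m), T.card = k + 1 → ∀ y : T → F,
      (Finset.univ.filter (fun x : Fin n → F => ∀ i : T, f x i = y i)).card =
        Fintype.card F ^ (n - (k + 1)))
    (hk1 : (2 : ℝ) ^ (t + 2) * Real.logb 2 s ≤ (k : ℝ)) (hk2 : k ≤ s)
    (P : (Fin n → F) → (Fin s → F))
    (Sq : Fin m → Finset (Fin s)) (hSq : ∀ i, (Sq i).card ≤ t)
    (Q : ∀ i : Fin m, (↥(Sq i) → F) → F)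
    (hQ : ∀ (x : Fin n → F) (i : Fin m), f x i = Q i (fun j : ↥(Sq i) => P x ↑j)) :
    (m : ℝ) < 3 * s * ((2 ^ (t + 3) * s * Real.logb 2 s) / k) ^ (t - 2) ∧
      (s : ℝ) ≥ ((m : ℝ) / 3) ^ ((1 : ℝ) / ((t : ℝ) - 1)) *
        ((k : ℝ) / (2 ^ (t + 3) * Real.logb 2 s)) ^ (((t : ℝ) - 2) / ((t : ℝ) - 1)) := by
  have hs0 : (0 : ℝ) < s := by positivity
  have hl1 : 1 ≤ Real.logb 2 s := by
    rw [Real.le_logb_iff_rpow_le (by norm_num) hs0]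
    simpa using (by exact_mod_cast hs : (2 : ℝ) ≤ s)
  have hpow : (32 : ℝ) ≤ 2 ^ (t + 2) := by
    calc (32 : ℝ) = 2 ^ 5 := by norm_num
      _ ≤ 2 ^ (t + 2) := pow_le_pow_right₀ (by norm_num) (by omega)
  have hk32 : (32 : ℝ) ≤ k := by nlinarith
  have hks : (k : ℝ) ≤ s := by exact_mod_cast hk2
  have hl2 : 2 ≤ Real.logb 2 s := by
    rw [Real.le_logb_iff_rpow_le (by norm_num) hs0]
    have : (2 : ℝ) ^ (2 : ℝ) = 4 := by norm_num
    rw [this]; linarith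
  set l := Real.logb 2 s with hl
  have hl0 : 0 < l := by linarith
  have hk0 : (0 : ℝ) < k := by linarith
  have hfirst : (m : ℝ) < 3 * s * ((2 ^ (t + 3) * s * l) / k) ^ (t - 2) := by
    by_contra hcon
    rw [not_lt] at hcon
    set x : ℝ := k / (2 ^ (t + 2) * l) with hx
    have hden : (0 : ℝ) < 2 ^ (t + 2) * l := by positivity
    have hx1 : 1 ≤ x := by rw [hx, le_div_iff₀ hden]; linarith
    have hkx : (k : ℝ) = x * (2 ^ (t + 2) * l) := by rw [hx]; field_simp
    have hxk : x ≤ k := by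
      rw [hx]; apply div_le_self hk0.le; nlinarith
    have hax : x ≤ ⌈x⌉₊ := Nat.le_ceil x
    have hax2 : (⌈x⌉₊ : ℝ) < x + 1 := Nat.ceil_lt_add_one (by linarith)
    have ha : 0 < ⌈x⌉₊ := Nat.ceil_pos.2 (by linarith)
    refine core F n m s k t ⌈x⌉₊ ht hs ha f hf hk2 P Sq hSq Q hQ ?_ ?_
    · have hlog : (Nat.log 2 s : ℝ) ≤ l := by
        rw [hl, Real.le_logb_iff_rpow_le (by norm_num) hs0, Real.rpow_natCast]
        exact_mod_cast Nat.pow_log_le_self 2 (by omega)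
      have hp : (10 : ℝ) * (2 * t - 3) ≤ 2 ^ (t + 2) := by
        have := pow_aux t ht
        have h2 : ((10 * (2 * t - 3) : ℕ) : ℝ) ≤ ((2 ^ (t + 2) : ℕ) : ℝ) := by exact_mod_cast this
        push_cast [Nat.cast_sub (show 3 ≤ 2 * t by omega)] at h2
        exact h2
      have ht3 : (3 : ℝ) ≤ t := by exact_mod_cast ht
      have h1 : ((t : ℝ) - 2) * ⌈x⌉₊ + 1 ≤ (2 * t - 3) * x := by nlinarith
      have h2 : 4 * (Nat.log 2 s : ℝ) + 9 ≤ 10 * l := by linarith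
      have : (((t : ℝ) - 2) * ⌈x⌉₊ + 1) * (4 * (Nat.log 2 s : ℝ) + 9) ≤ k := by
        calc _ ≤ ((2 * t - 3) * x) * (10 * l) := by
              apply mul_le_mul h1 h2 (by positivity)
              have : (0 : ℝ) ≤ 2 * t - 3 := by linarith
              positivity
          _ = (10 * (2 * t - 3)) * (x * l) := by ring
          _ ≤ 2 ^ (t + 2) * (x * l) := by
              apply mul_le_mul_of_nonneg_right hp; positivity
          _ = k := by rw [hkx]; ring
      have h3 : (((((t - 2) * ⌈x⌉₊ + 1) * (4 * Nat.log 2 s + 9) : ℕ)) : ℝ) ≤ (k : ℝ) := by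
        push_cast [Nat.cast_sub (show 2 ≤ t by omega)]
        exact this
      exact_mod_cast h3
    · have hB : ((s / ⌈x⌉₊ + 1 : ℕ) : ℝ) ≤ (2 ^ (t + 3) * s * l) / k := by
        have h1 : ((s / ⌈x⌉₊ : ℕ) : ℝ) ≤ s / x := by
          calc ((s / ⌈x⌉₊ : ℕ) : ℝ) ≤ (s : ℝ) / ⌈x⌉₊ := Nat.cast_div_le
            _ ≤ s / x := by gcongr
        have h2 : 1 ≤ (s : ℝ) / x := by
          rw [le_div_iff₀ (by linarith)]; linarith
        have h3 : (2 ^ (t + 3) * s * l) / k = 2 * (s / x) := by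
          rw [hx]; field_simp; ring
        rw [h3]; push_cast; linarith
      have : (((s / ⌈x⌉₊ + 1) ^ (t - 2) * (3 * s) : ℕ) : ℝ) ≤ (m : ℝ) := by
        refine le_trans ?_ hcon
        rw [Nat.cast_mul, Nat.cast_pow, mul_comm]
        push_cast at hB ⊢
        gcongr
      exact_mod_cast this
  refine ⟨hfirst, ?_⟩
  have ht3 : (3 : ℝ) ≤ t := by exact_mod_cast ht
  set y : ℝ := k / (2 ^ (t + 3) * l) with hy
  have hy0 : 0 < y := by positivity
  have hm3 : (m : ℝ) / 3 * y ^ (t - 2) ≤ (s : ℝ) ^ (t - 1) := by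
    have h1 : (2 ^ (t + 3) * s * l) / k = s / y := by rw [hy]; field_simp
    rw [h1, div_pow] at hfirst
    have h2 : (m : ℝ) / 3 ≤ s * (s ^ (t - 2) / y ^ (t - 2)) := by linarith
    calc (m : ℝ) / 3 * y ^ (t - 2) ≤ s * (s ^ (t - 2) / y ^ (t - 2)) * y ^ (t - 2) := by
          gcongr
      _ = s ^ (t - 2) * s := by field_simp
      _ = s ^ (t - 1) := by rw [← pow_succ]; congr 1; omega
  have hc2 : ((t - 2 : ℕ) : ℝ) = t - 2 := by push_cast [Nat.cast_sub (show 2 ≤ t by omega)]; rfl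
  have hc1 : ((t - 1 : ℕ) : ℝ) = t - 1 := by push_cast [Nat.cast_sub (show 1 ≤ t by omega)]; rfl
  have ht1 : (0 : ℝ) < t - 1 := by linarith
  have h5 := Real.rpow_le_rpow (by positivity) hm3 (z := 1 / ((t : ℝ) - 1)) (by positivity)
  rw [Real.mul_rpow (by positivity) (by positivity), ← Real.rpow_natCast, ← Real.rpow_natCast,
    ← Real.rpow_mul hy0.le, ← Real.rpow_mul hs0.le, hc1, hc2, mul_one_div, mul_one_div,
    div_self ht1.ne', Real.rpow_one] at h5
  exact h5
end
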